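/- Let A be a real symmetric positive definite n×n matrix, x_* = A⁻¹y, t an initial guess with error c = x_* − t ≠ 0, and z = y − At. Suppose z = z̃ + δz with z̃ ≠ 0, (z̃, δz) = 0, and ‖δz‖_A ≤ ε‖z̃‖_A ≤ ε‖z‖_A. Let d = c − z·(‖z‖²/‖z‖_A²) and d̃ = c − z̃·(‖z̃‖²/‖z̃‖_A²). Then ‖d̃ − d‖_A / ‖c‖_A ≤ ε√(2(1 − ω_z²)) + ε³ cond²(A)/(2√2), where ω_z² = 1 − ‖z‖⁴/((z,Az)(z,A⁻¹z)) and cond(A) = λmax(A)/λmin(A). -/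

import Mathlib

open Matrix

/-- The A-norm `‖u‖_A = √(uᵀAu)`. -/
noncomputable def anorm {n : ℕ} (A : Matrix (Fin n) (Fin n) ℝ) (u : Fin n → ℝ) : ℝ :=
  Real.sqrt (u ⬝ᵥ A *ᵥ u)

/-- The A-orthogonal projector onto span{z}: `R_z = z zᵀ A / (zᵀAz)`. -/
noncomputable def Rvec {n : ℕ} (A : Matrix (Fin n) (Fin n) ℝ) (z : Fin n → ℝ) :
    Matrix (Fin n) (Fin n) ℝ :=
  (z ⬝ᵥ A *ᵥ z)⁻¹ • (Matrix.vecMulVec z z * A)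

/-- The A-orthogonal projector onto the column span of Z: `R_Z = Z (ZᵀAZ)⁻¹ Zᵀ A`. -/
noncomputable def Rmat {n m : ℕ} (A : Matrix (Fin n) (Fin n) ℝ) (Z : Matrix (Fin n) (Fin m) ℝ) :
    Matrix (Fin n) (Fin n) ℝ :=
  Z * (Zᵀ * A * Z)⁻¹ * Zᵀ * A

section RayleighBounds

open scoped MatrixOrder

/-- The smallest eigenvalue bounds the quadratic form from below. -/
lemma Matrix.IsHermitian.iInf_eigenvalues_mul_le {n : ℕ} {A : Matrix (Fin n) (Fin n) ℝ}
    (hA : A.IsHermitian) (u : Fin n → ℝ) :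
    (⨅ i, hA.eigenvalues i) * (u ⬝ᵥ u) ≤ u ⬝ᵥ A *ᵥ u := by
  have h : algebraMap ℝ (Matrix (Fin n) (Fin n) ℝ) (⨅ i, hA.eigenvalues i) ≤ A := by
    refine algebraMap_le_of_le_spectrum (fun x hx => ?_) hA.isSelfAdjoint
    rw [hA.spectrum_real_eq_range_eigenvalues] at hx
    obtain ⟨i, rfl⟩ := hx
    exact ciInf_le (Set.finite_range _).bddBelow i
  have h2 := (Matrix.le_iff.1 h).dotProduct_mulVec_nonneg u
  rw [Algebra.algebraMap_eq_smul_one, Matrix.sub_mulVec, Matrix.smul_mulVec, Matrix.one_mulVec,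
    dotProduct_sub, dotProduct_smul, star_trivial, smul_eq_mul] at h2
  linarith

/-- The largest eigenvalue bounds the quadratic form from above. -/
lemma Matrix.IsHermitian.le_iSup_eigenvalues_mul {n : ℕ} {A : Matrix (Fin n) (Fin n) ℝ}
    (hA : A.IsHermitian) (u : Fin n → ℝ) :
    u ⬝ᵥ A *ᵥ u ≤ (⨆ i, hA.eigenvalues i) * (u ⬝ᵥ u) := by
  have h : A ≤ algebraMap ℝ (Matrix (Fin n) (Fin n) ℝ) (⨆ i, hA.eigenvalues i) := by
    refine le_algebraMap_of_spectrum_le (fun x hx => ?_) hA.isSelfAdjoint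
    rw [hA.spectrum_real_eq_range_eigenvalues] at hx
    obtain ⟨i, rfl⟩ := hx
    exact le_ciSup (Set.finite_range _).bddAbove i
  have h2 := (Matrix.le_iff.1 h).dotProduct_mulVec_nonneg u
  rw [Algebra.algebraMap_eq_smul_one, Matrix.sub_mulVec, Matrix.smul_mulVec, Matrix.one_mulVec,
    dotProduct_sub, dotProduct_smul, star_trivial, smul_eq_mul] at h2
  linarith

end RayleighBounds

lemma Matrix.IsHermitian.dotProduct_mulVec_swap {n : ℕ} {A : Matrix (Fin n) (Fin n) ℝ}
    (hA : A.IsHermitian) (u v : Fin n → ℝ) : u ⬝ᵥ A *ᵥ v = v ⬝ᵥ A *ᵥ u := by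
  have hT : Aᵀ = A := by simpa [Matrix.conjTranspose_eq_transpose_of_trivial] using hA.eq
  rw [dotProduct_mulVec, ← mulVec_transpose, hT, dotProduct_comm]

lemma Matrix.IsHermitian.dotProduct_mulVec_sub_smul {n : ℕ} {A : Matrix (Fin n) (Fin n) ℝ}
    (hA : A.IsHermitian) (α β : ℝ) (u v : Fin n → ℝ) :
    (α • u - β • v) ⬝ᵥ A *ᵥ (α • u - β • v) =
      α ^ 2 * (u ⬝ᵥ A *ᵥ u) - 2 * α * β * (u ⬝ᵥ A *ᵥ v) + β ^ 2 * (v ⬝ᵥ A *ᵥ v) := by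
  simp only [mulVec_sub, mulVec_smul, sub_dotProduct, dotProduct_sub, smul_dotProduct,
    dotProduct_smul, smul_eq_mul, hA.dotProduct_mulVec_swap v u]
  ring

/-- Cauchy-Schwarz inequality in the A-inner product of `A *ᵥ c` and `c`. -/
lemma Matrix.PosDef.sq_dotProduct_mulVec_le {n : ℕ} {A : Matrix (Fin n) (Fin n) ℝ}
    (hA : A.PosDef) (c : Fin n → ℝ) (hz : 0 < (A *ᵥ c) ⬝ᵥ A *ᵥ (A *ᵥ c)) :
    ((A *ᵥ c) ⬝ᵥ (A *ᵥ c)) ^ 2 ≤ ((A *ᵥ c) ⬝ᵥ A *ᵥ (A *ᵥ c)) * (c ⬝ᵥ A *ᵥ c) := by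
  set z := A *ᵥ c with hzdef
  have h := hA.posSemidef.dotProduct_mulVec_nonneg ((z ⬝ᵥ A *ᵥ z) • c - (z ⬝ᵥ z) • z)
  have hcz : c ⬝ᵥ A *ᵥ z = z ⬝ᵥ z := by rw [hA.1.dotProduct_mulVec_swap]
  rw [star_trivial, hA.1.dotProduct_mulVec_sub_smul, hcz, ← hzdef] at h
  have h2 : 0 ≤ (z ⬝ᵥ A *ᵥ z) * ((z ⬝ᵥ A *ᵥ z) * (c ⬝ᵥ z) - (z ⬝ᵥ z) ^ 2) := by
    linarith
  linarith [nonneg_of_mul_nonneg_right h2 hz]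

/-- Bound on the squared A-norm of the difference of two steepest descent corrections, in terms
of the scalars `‖z‖²`, `‖z̃‖²`, `‖δz‖²` and the squared A-norms `a`, `b`, `g` of `z`, `z̃`, `δz`. -/
lemma sd_step_difference_bound {s σ e a b h g ε κ : ℝ} (ha : 0 < a) (hb : 0 < b) (hba : b ≤ a)
    (hσ : 0 ≤ σ) (he : 0 ≤ e) (hs : s = σ + e) (hah : a = b + 2 * h + g)
    (hg : g ≤ ε ^ 2 * b) (heκ : e ≤ ε ^ 2 * κ * σ) :
    (σ / b) ^ 2 * b - 2 * (σ / b) * (s / a) * (b + h) + (s / a) ^ 2 * a ≤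
      (ε ^ 2 + ε ^ 4 * κ ^ 2) * (s ^ 2 / a) := by
  have hh : h = (a - b - g) / 2 := by linarith
  have hid : (σ / b) ^ 2 * b - 2 * (σ / b) * (s / a) * (b + h) + (s / a) ^ 2 * a =
      (e * (s - σ * (a / b)) + s * σ * (g / b)) / a := by
    subst hh hs
    field_simp
    ring
  rw [hid, ← mul_div_assoc (ε ^ 2 + ε ^ 4 * κ ^ 2)]
  refine div_le_div_of_nonneg_right ?_ ha.le
  have h1 : 1 ≤ a / b := (one_le_div hb).2 hba
  have h2 : g / b ≤ ε ^ 2 := (div_le_iff₀ hb).2 hg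
  have hs0 : 0 ≤ s := by linarith
  have hσs : σ ≤ s := by linarith
  have h3 : e * (s - σ * (a / b)) ≤ e ^ 2 := by
    have : s - σ * (a / b) ≤ e := by nlinarith
    nlinarith
  have h4 : e ^ 2 ≤ (ε ^ 2 * κ * σ) ^ 2 := by gcongr
  have h5 : σ ^ 2 ≤ s ^ 2 := by gcongr
  have h6 : s * σ * (g / b) ≤ s * s * ε ^ 2 := by
    calc s * σ * (g / b) ≤ s * σ * ε ^ 2 := by gcongr
      _ ≤ s * s * ε ^ 2 := by gcongr
  have h7 : (ε ^ 2 * κ) ^ 2 * σ ^ 2 ≤ (ε ^ 2 * κ) ^ 2 * s ^ 2 := by gcongr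
  linarith

lemma sqrt_le_add_of_le_mul {Q r ε κ : ℝ} (hε : 0 ≤ ε) (hr0 : 0 ≤ r) (hr1 : r ≤ 1)
    (hQ : Q ≤ (ε ^ 2 + ε ^ 4 * κ ^ 2) * r) :
    √Q ≤ ε * √(2 * r) + ε ^ 3 * κ ^ 2 / (2 * √2) := by
  refine Real.sqrt_le_iff.2 ⟨by positivity, hQ.trans ?_⟩
  have hr : r ≤ √r := Real.le_sqrt_of_sq_le (by nlinarith)
  have h2 : (√2) ^ 2 = 2 := Real.sq_sqrt (by norm_num)
  have hrr : √r ^ 2 = r := Real.sq_sqrt hr0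
  have hid : (ε * √(2 * r) + ε ^ 3 * κ ^ 2 / (2 * √2)) ^ 2 =
      2 * ε ^ 2 * r + ε ^ 4 * κ ^ 2 * √r + (ε ^ 3 * κ ^ 2) ^ 2 / 8 := by
    have hcross : √2 * √r * (ε ^ 3 * κ ^ 2 / (2 * √2)) = ε ^ 3 * κ ^ 2 * √r / 2 := by
      field_simp
    rw [Real.sqrt_mul (by norm_num)]
    calc (ε * (√2 * √r) + ε ^ 3 * κ ^ 2 / (2 * √2)) ^ 2
        = ε ^ 2 * √2 ^ 2 * √r ^ 2 + 2 * ε * (√2 * √r * (ε ^ 3 * κ ^ 2 / (2 * √2))) +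
          (ε ^ 3 * κ ^ 2) ^ 2 / (4 * √2 ^ 2) := by ring
      _ = _ := by
        rw [hcross, h2, hrr]
        ring
  rw [hid]
  have h3 : ε ^ 4 * κ ^ 2 * r ≤ ε ^ 4 * κ ^ 2 * √r := by gcongr
  have h4 : 0 ≤ ε ^ 2 * r := by positivity
  have h5 : 0 ≤ (ε ^ 3 * κ ^ 2) ^ 2 / 8 := by positivity
  linarith

/-- relative bound on the difference between the perturbed and
exact steepest descent errors. -/
theorem relative_perturbation_of_sd_step
    {n : ℕ} (hn : 0 < n) (A : Matrix (Fin n) (Fin n) ℝ) (hA : A.PosDef)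
    (y t xstar c z zt δz d dt : Fin n → ℝ) (ε : ℝ)
    (hxstar : xstar = A⁻¹ *ᵥ y)
    (hc : c = xstar - t) (hc0 : c ≠ 0)
    (hz : z = y - A *ᵥ t)
    (hsplit : z = zt + δz) (hzt0 : zt ≠ 0)
    (horth : zt ⬝ᵥ δz = 0)
    (hpert1 : anorm A δz ≤ ε * anorm A zt)
    (hpert2 : ε * anorm A zt ≤ ε * anorm A z)
    (hd : d = c - ((z ⬝ᵥ z) / (z ⬝ᵥ A *ᵥ z)) • z)
    (hdt : dt = c - ((zt ⬝ᵥ zt) / (zt ⬝ᵥ A *ᵥ zt)) • zt)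
    (ωz lmin lmax condA : ℝ)
    (hω : ωz = Real.sqrt (1 - (z ⬝ᵥ z) ^ 2 / ((z ⬝ᵥ A *ᵥ z) * (z ⬝ᵥ A⁻¹ *ᵥ z))))
    (hmin : lmin = ⨅ i, hA.1.eigenvalues i)
    (hmax : lmax = ⨆ i, hA.1.eigenvalues i)
    (hcond : condA = lmax / lmin) :
    anorm A (dt - d) / anorm A c ≤
      ε * Real.sqrt (2 * (1 - ωz ^ 2)) + ε ^ 3 * condA ^ 2 / (2 * Real.sqrt 2) := by
  have hpos : ∀ u : Fin n → ℝ, u ≠ 0 → 0 < u ⬝ᵥ A *ᵥ u := fun u hu => by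
    simpa using hA.dotProduct_mulVec_pos hu
  have hnonneg : ∀ u : Fin n → ℝ, 0 ≤ u ⬝ᵥ A *ᵥ u := fun u => by
    simpa using hA.posSemidef.dotProduct_mulVec_nonneg u
  have hdet : IsUnit A.det := hA.det_pos.ne'.isUnit
  have hzc : z = A *ᵥ c := by
    rw [hc, hxstar, mulVec_sub, mulVec_mulVec, mul_nonsing_inv _ hdet, one_mulVec, hz]
  have hinv : A⁻¹ *ᵥ z = c := by
    rw [hzc, mulVec_mulVec, nonsing_inv_mul _ hdet, one_mulVec]
  have hz0 : z ≠ 0 := fun h => hc0 (by rw [← hinv, h, mulVec_zero])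
  have hC := hpos c hc0
  rw [← hzc] at hC
  have ha := hpos z hz0
  have hb := hpos zt hzt0
  have hbn : 0 < anorm A zt := Real.sqrt_pos.2 hb
  have hε : 0 ≤ ε :=
    nonneg_of_mul_nonneg_left ((Real.sqrt_nonneg _).trans hpert1) hbn
  have hcs := hA.sq_dotProduct_mulVec_le c (hzc ▸ ha)
  rw [← hzc] at hcs
  have hzz : z ⬝ᵥ z = zt ⬝ᵥ zt + δz ⬝ᵥ δz := by
    rw [hsplit]
    simp only [add_dotProduct, dotProduct_add, horth, dotProduct_comm δz zt]
    ring
  have hzAz : z ⬝ᵥ A *ᵥ z =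
      zt ⬝ᵥ A *ᵥ zt + 2 * (zt ⬝ᵥ A *ᵥ δz) + δz ⬝ᵥ A *ᵥ δz := by
    rw [hsplit]
    simp only [add_dotProduct, dotProduct_add, mulVec_add, hA.1.dotProduct_mulVec_swap δz zt]
    ring
  have hg : δz ⬝ᵥ A *ᵥ δz ≤ ε ^ 2 * (zt ⬝ᵥ A *ᵥ zt) := by
    have h := pow_le_pow_left₀ (Real.sqrt_nonneg _) hpert1 2
    rwa [mul_pow, anorm, Real.sq_sqrt (hnonneg _), Real.sq_sqrt (hnonneg _)] at h
  have hba : zt ⬝ᵥ A *ᵥ zt ≤ z ⬝ᵥ A *ᵥ z := by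
    rcases hε.eq_or_lt with h0 | hε0
    · have hδ : δz = 0 := by
        by_contra hne
        have := hpos δz hne
        rw [← h0] at hg
        linarith
      rw [hsplit, hδ, add_zero]
    · exact (Real.sqrt_le_sqrt_iff ha.le).1 (le_of_mul_le_mul_left hpert2 hε0)
  have hlmin : 0 < lmin := by
    have : Nonempty (Fin n) := ⟨⟨0, hn⟩⟩
    obtain ⟨i, hi⟩ := exists_eq_ciInf_of_finite (f := hA.1.eigenvalues)
    rw [hmin, ← hi]
    exact hA.eigenvalues_pos i
  have hδ0 : 0 ≤ δz ⬝ᵥ δz := by simpa using dotProduct_star_self_nonneg δz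
  have hσ0 : 0 ≤ zt ⬝ᵥ zt := by simpa using dotProduct_star_self_nonneg zt
  have heκ : δz ⬝ᵥ δz ≤ ε ^ 2 * condA * (zt ⬝ᵥ zt) := by
    have h1 := hA.1.iInf_eigenvalues_mul_le δz
    have h2 := hA.1.le_iSup_eigenvalues_mul zt
    rw [← hmin] at h1
    rw [← hmax] at h2
    have h3 : ε ^ 2 * condA * (zt ⬝ᵥ zt) = ε ^ 2 * (lmax * (zt ⬝ᵥ zt)) / lmin := by
      rw [hcond]
      ring
    rw [h3, le_div_iff₀ hlmin, mul_comm]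
    exact h1.trans (hg.trans (by gcongr))
  set r := (z ⬝ᵥ z) ^ 2 / ((z ⬝ᵥ A *ᵥ z) * (c ⬝ᵥ z)) with hr
  have hr0 : 0 ≤ r := by positivity
  have hr1 : r ≤ 1 := div_le_one_of_le₀ hcs (by positivity)
  have hωr : 1 - ωz ^ 2 = r := by
    rw [hω, hinv, dotProduct_comm z c, ← hr, Real.sq_sqrt (by linarith)]
    ring
  have hdiff : (dt - d) ⬝ᵥ A *ᵥ (dt - d) ≤
      (ε ^ 2 + ε ^ 4 * condA ^ 2) * ((z ⬝ᵥ z) ^ 2 / (z ⬝ᵥ A *ᵥ z)) := by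
    have hsub : dt - d = -(((zt ⬝ᵥ zt) / (zt ⬝ᵥ A *ᵥ zt)) • zt -
        ((z ⬝ᵥ z) / (z ⬝ᵥ A *ᵥ z)) • z) := by
      rw [hd, hdt]
      abel
    have hcross : zt ⬝ᵥ A *ᵥ z = zt ⬝ᵥ A *ᵥ zt + zt ⬝ᵥ A *ᵥ δz := by
      rw [hsplit, mulVec_add, dotProduct_add]
    rw [hsub, mulVec_neg, neg_dotProduct_neg, hA.1.dotProduct_mulVec_sub_smul, hcross]
    exact sd_step_difference_bound ha hb hba hσ0 hδ0 hzz hzAz hg heκ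
  rw [hωr, anorm, anorm, ← Real.sqrt_div (hnonneg _)]
  refine sqrt_le_add_of_le_mul hε hr0 hr1 ?_
  rw [← hzc, div_le_iff₀ hC]
  refine hdiff.trans_eq ?_
  rw [hr]
  field_simp
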